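/- Let $f:[0,\infty)\to\mathbb{R}$ be locally bounded and measurable with $\int_0^1 f^2(y)\,dy>0$, and let $W$ be a standard Brownian motion. Set $Z=\sup_{t\in[0,1]}\big|\int_{(0,t]}f(t-x)\,dW(x)\big|$, assumed a.s. finite and continuous in $t$. Then $-\log\mathbb{P}\{Z>u\}\sim \frac{u^2}{2\int_0^1 f^2(y)\,dy}$ as $u\to\infty$. -/

import Mathlib

open MeasureTheory ProbabilityTheory Filter Real Asymptotics
open scoped ENNReal NNReal

lemma aux_asymp (p : ℝ → ℝ) (S : ℝ) (hS : 0 < S)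
    (hlow : ∃ c > 0, ∀ u ≥ 0, c * rexp (-(u+1)^2/(2*S)) ≤ p u)
    (hup : ∀ ε : ℝ, 0 < ε → ε < 1 → ∃ K > 0, ∀ u ≥ 0, p u ≤ K * rexp (-((1-ε)*u)^2/(2*S))) :
    (fun u : ℝ => -Real.log (p u)) ~[atTop] fun u : ℝ => u ^ 2 / (2 * S) := by
  unfold Asymptotics.IsEquivalent
  rw [Asymptotics.isLittleO_iff]
  intro η hη
  obtain ⟨c, hc, hlow⟩ := hlow
  obtain ⟨K, hK, hup⟩ := hup (min (η/4) (1/2)) (by positivity) (by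
    have := min_le_right (η/4) (1/2 : ℝ); linarith)
  set ε := min (η/4) (1/2) with hε
  have hε1 : ε ≤ η/4 := min_le_left _ _
  have hε2 : ε ≤ 1/2 := min_le_right _ _
  have hε0 : 0 < ε := by positivity
  have e1 : ∀ᶠ u : ℝ in atTop, Real.log K ≤ (η/2) * (u^2/(2*S)) := by
    have : Tendsto (fun u : ℝ => (η/2) * (u^2/(2*S))) atTop atTop := by
      apply Tendsto.const_mul_atTop (by positivity)
      apply Tendsto.atTop_div_const (by positivity)
      exact tendsto_pow_atTop (by norm_num)
    exact this.eventually_ge_atTop _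
  have e2 : ∀ᶠ u : ℝ in atTop, -Real.log c ≤ (η/2) * (u^2/(2*S)) := by
    have : Tendsto (fun u : ℝ => (η/2) * (u^2/(2*S))) atTop atTop := by
      apply Tendsto.const_mul_atTop (by positivity)
      apply Tendsto.atTop_div_const (by positivity)
      exact tendsto_pow_atTop (by norm_num)
    exact this.eventually_ge_atTop _
  filter_upwards [e1, e2, eventually_ge_atTop (1:ℝ), eventually_ge_atTop (6/η)] with u h1 h2 hu hu2
  have hp : 0 < p u := lt_of_lt_of_le (by positivity) (hlow u (by linarith))
  have l1 := Real.log_le_log (by positivity) (hlow u (by linarith))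
  have l2 := Real.log_le_log hp (hup u (by linarith))
  rw [Real.log_mul hc.ne' (Real.exp_pos _).ne', Real.log_exp] at l1
  rw [Real.log_mul hK.ne' (Real.exp_pos _).ne', Real.log_exp] at l2
  have hu3 : 6 ≤ η * u := by rw [div_le_iff₀ hη] at hu2; linarith
  have hg : 0 ≤ u^2/(2*S) := by positivity
  simp only [Pi.sub_apply, Real.norm_eq_abs]
  rw [abs_of_nonneg hg, abs_le]
  have q1 : (u+1)^2/(2*S) ≤ (1+η/2) * (u^2/(2*S)) := by
    rw [← mul_div_assoc]
    apply div_le_div_of_nonneg_right _ (by positivity)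
    nlinarith
  have q2 : (1-η/2) * (u^2/(2*S)) ≤ ((1-ε)*u)^2/(2*S) := by
    rw [← mul_div_assoc]
    apply div_le_div_of_nonneg_right _ (by positivity)
    rw [mul_pow]
    apply mul_le_mul_of_nonneg_right _ (by positivity)
    nlinarith
  rw [neg_div] at l1 l2
  constructor <;> linarith

lemma aux_lower (v : ℝ≥0) (hv : 0 < (v:ℝ)) : ∃ c > 0, ∀ u ≥ 0,
    c * rexp (-(u+1)^2/(2*v)) ≤ (gaussianReal 0 v).real {x | u < |x|} := by
  have hv' : v ≠ 0 := by rintro rfl; simp at hv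
  refine ⟨(√(2 * π * v))⁻¹, by positivity, fun u hu => ?_⟩
  have h1 : (gaussianReal 0 v).real (Set.Ioc u (u+1)) ≤ (gaussianReal 0 v).real {x | u < |x|} := by
    refine measureReal_mono ?_ (measure_ne_top _ _)
    intro x hx
    exact lt_of_lt_of_le hx.1 (le_abs_self x)
  refine le_trans ?_ h1
  rw [measureReal_def, gaussianReal_apply_eq_integral 0 hv', ENNReal.toReal_ofReal
    (setIntegral_nonneg measurableSet_Ioc fun x _ => gaussianPDFReal_nonneg _ _ _)]
  have : (√(2 * π * v))⁻¹ * rexp (-(u+1)^2/(2*v))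
      = ∫ x in Set.Ioc u (u+1), (√(2 * π * v))⁻¹ * rexp (-(u+1)^2/(2*v)) := by
    simp
  rw [this]
  apply setIntegral_mono_on (integrableOn_const (by simp)) (integrable_gaussianPDFReal _ _).integrableOn measurableSet_Ioc
  intro x hx
  unfold gaussianPDFReal
  gcongr
  · linarith [hx.1]
  · linarith [hx.2]

lemma aux_upper {Ω : Type*} [MeasurableSpace Ω] {μ : Measure Ω} [IsProbabilityMeasure μ]
    (X : Ω → ℝ) (v S : ℝ≥0) (hvS : v ≤ S) (h : μ.map X = gaussianReal 0 v) (u : ℝ) (hu : 0 ≤ u) :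
    μ.real {ω | u ≤ |X ω|} ≤ 2 * rexp (-u^2/(2*S)) := by
  have hX_meas : AEMeasurable X μ := aemeasurable_of_map_neZero (by rw [h]; infer_instance)
  have hs : HasSubgaussianMGF X S μ := by
    constructor
    · intro t
      have := integrable_exp_mul_gaussianReal (μ := 0) (v := v) t
      rw [← h] at this
      exact this.comp_aemeasurable hX_meas
    · intro t
      rw [mgf_gaussianReal h]
      have : (v:ℝ) ≤ S := hvS
      simp only [zero_mul, zero_add]
      gcongr
  have h1 := hs.measure_ge_le hu
  have h2 := hs.neg.measure_ge_le hu
  calc μ.real {ω | u ≤ |X ω|} ≤ μ.real ({ω | u ≤ X ω} ∪ {ω | u ≤ (-X) ω}) := by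
        refine measureReal_mono ?_ (measure_ne_top _ _)
        intro ω hω
        exact le_abs.1 (show u ≤ |X ω| from hω)
    _ ≤ _ := measureReal_union_le _ _
    _ ≤ _ := by linarith

open Fernique in
lemma aux_fernique : ∃ C κ : ℝ, 0 < C ∧ 0 < κ ∧ ∀ {Ω : Type*} [MeasurableSpace Ω] {μ : Measure Ω}
    [IsProbabilityMeasure μ] (n : ℕ) (X : Fin n → Ω → ℝ) (hX : ∀ i, Measurable (X i))
    (hG : ∀ c : Fin n → ℝ, ∃ v : ℝ≥0, μ.map (fun ω => ∑ i, c i * X i ω) = gaussianReal 0 v)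
    (a : ℝ) (ha : 0 < a) (h : 3/4 ≤ μ {ω | ∀ i, |X i ω| ≤ a}) (b : ℝ) (hb : 0 ≤ b),
    μ {ω | ∃ i, b < |X i ω|} ≤ ENNReal.ofReal (C * rexp (-(κ * (b/a)^2))) := by
  have h34 : (2⁻¹ : ℝ≥0∞) < 3/4 := by
    rw [← ENNReal.toReal_lt_toReal (by finiteness) (by finiteness)]
    norm_num
  have h34' : (3/4 : ℝ≥0∞) < 1 := by
    rw [← ENNReal.toReal_lt_toReal (by finiteness) (by finiteness)]
    norm_num
  set c : ℝ≥0∞ := 3/4 with hc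
  set D : ℝ≥0∞ := .ofReal (rexp (logRatio c))
        + ∑' n, .ofReal (rexp (-2⁻¹ * Real.log (c / (1 - c)).toReal * 2 ^ n)) with hD
  have hDtop : D ≠ ∞ := by
    refine (ENNReal.add_lt_top.mpr ⟨ENNReal.ofReal_lt_top, ?_⟩).ne
    refine Summable.tsum_ofReal_lt_top <|
      Real.summable_exp_nat_mul_of_ge ?_ (fun i ↦ mod_cast (Nat.lt_pow_self (by simp)).le)
    refine mul_neg_of_neg_of_pos (by simp) (Real.log_pos ?_)
    rw [ENNReal.toReal_div, ENNReal.toReal_sub_of_le h34'.le (by simp), hc]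
    norm_num
  have hDpos : 0 < D := by
    rw [hD]
    exact lt_of_lt_of_le (ENNReal.ofReal_pos.2 (Real.exp_pos _)) le_self_add
  refine ⟨D.toReal, logRatio c, ENNReal.toReal_pos hDpos.ne' hDtop, logRatio_pos h34 h34', ?_⟩
  intro Ω _ μ _ n X hX hG a ha h b hb
  set Y : Ω → (Fin n → ℝ) := fun ω i => X i ω with hY
  have hYm : Measurable Y := measurable_pi_lambda _ hX
  set ν := μ.map Y with hν
  have hL : ∀ L : (Fin n → ℝ) →L[ℝ] ℝ, ∃ v : ℝ≥0, ν.map L = gaussianReal 0 v := by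
    intro L
    obtain ⟨v, hv⟩ := hG (fun i => L (Pi.single i 1))
    refine ⟨v, ?_⟩
    rw [← hv, hν, Measure.map_map (by fun_prop) hYm]
    congr 1
    ext ω
    simp only [Function.comp]
    conv_lhs => rw [pi_eq_sum_univ' (Y ω)]
    rw [map_sum]
    refine Finset.sum_congr rfl fun i _ => ?_
    rw [map_smul, smul_eq_mul, mul_comm]
  have : IsGaussian ν := isGaussian_of_map_eq_gaussianReal fun L => ⟨0, hL L⟩
  have hrot := IsGaussian.map_rotation_eq_self_of_forall_strongDual_eq_zero (μ := ν) (fun L => by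
    obtain ⟨v, hv⟩ := hL L
    have : ∫ x, L x ∂ν = ∫ x, x ∂(ν.map L) := 
      (integral_map (φ := L) (f := fun x => x) (by fun_prop) (by fun_prop)).symm
    rw [this, hv, integral_id_gaussianReal]) (-(π/4))
  have hle : c ≤ ν {x | ‖x‖ ≤ a} := by
    rw [hν, Measure.map_apply hYm (measurableSet_le (by fun_prop) (by fun_prop))]
    refine h.trans (measure_mono fun ω hω => ?_)
    simp only [Set.mem_preimage, Set.mem_ofPred_eq]
    rw [pi_norm_le_iff_of_nonneg ha.le]
    exact hω
  have hF := lintegral_exp_mul_sq_norm_le_of_map_rotation_eq_self hrot hle h34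
  have hM := (mul_meas_ge_le_lintegral₀ (μ := ν)
    (f := fun x => ENNReal.ofReal (rexp (logRatio c * a⁻¹ ^ 2 * ‖x‖ ^ 2))) (by fun_prop)
    (ENNReal.ofReal (rexp (logRatio c * (b/a)^2)))).trans hF
  have hsub : μ {ω | ∃ i, b < |X i ω|} ≤ ν {x | ENNReal.ofReal (rexp (logRatio c * (b/a)^2)) ≤
      ENNReal.ofReal (rexp (logRatio c * a⁻¹ ^ 2 * ‖x‖ ^ 2))} := by
    rw [hν, Measure.map_apply hYm (measurableSet_le (by fun_prop) (by fun_prop))]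
    refine measure_mono fun ω hω => ?_
    obtain ⟨i, hi⟩ := hω
    have : b ≤ ‖Y ω‖ := hi.le.trans (norm_le_pi_norm (Y ω) i)
    simp only [Set.mem_preimage, Set.mem_ofPred_eq]
    apply ENNReal.ofReal_le_ofReal
    apply Real.exp_le_exp.2
    rw [mul_assoc, ← mul_pow]
    have := logRatio_pos h34 h34'
    gcongr
    rw [div_eq_inv_mul]
    gcongr
  have h3 : ENNReal.ofReal (rexp (logRatio c * (b/a)^2)) * μ {ω | ∃ i, b < |X i ω|} ≤ D :=
    (by gcongr : _ ≤ _).trans hM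
  rw [ENNReal.ofReal_mul ENNReal.toReal_nonneg, ENNReal.ofReal_toReal hDtop, Real.exp_neg,
    ENNReal.ofReal_inv_of_pos (Real.exp_pos _), ← div_eq_mul_inv,
    ENNReal.le_div_iff_mul_le (Or.inl (ENNReal.ofReal_pos.2 (Real.exp_pos _)).ne') (Or.inl (by finiteness)), mul_comm]
  exact h3

lemma aux_fernique_nat : ∃ C κ : ℝ, 0 < C ∧ 0 < κ ∧ ∀ {Ω : Type*} [MeasurableSpace Ω] {μ : Measure Ω}
    [IsProbabilityMeasure μ] (X : ℕ → Ω → ℝ) (_hX : ∀ i, Measurable (X i))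
    (_hG : ∀ (n : ℕ) (c : Fin n → ℝ), ∃ v : ℝ≥0,
      μ.map (fun ω => ∑ i, c i * X i ω) = gaussianReal 0 v)
    (a : ℝ) (_ha : 0 < a) (_h : 3/4 ≤ μ {ω | ∀ i, |X i ω| ≤ a}) (b : ℝ) (_hb : 0 ≤ b),
    μ {ω | ∃ i, b < |X i ω|} ≤ ENNReal.ofReal (C * rexp (-(κ * (b/a)^2))) := by
  obtain ⟨C, κ, hC, hκ, H⟩ := aux_fernique
  refine ⟨C, κ, hC, hκ, ?_⟩
  intro Ω _ μ _ X hX hG a ha h b hb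
  have hU : {ω | ∃ i, b < |X i ω|} = ⋃ n : ℕ, {ω | ∃ i : Fin n, b < |X i ω|} := by
    ext ω
    simp only [Set.mem_iUnion, Set.mem_ofPred_eq]
    constructor
    · rintro ⟨i, hi⟩
      exact ⟨i+1, ⟨i, by omega⟩, hi⟩
    · rintro ⟨n, i, hi⟩
      exact ⟨i, hi⟩
  have hmono : Monotone fun n : ℕ => {ω | ∃ i : Fin n, b < |X i ω|} := by
    rintro m n hmn ω ⟨i, hi⟩
    exact ⟨⟨i, by omega⟩, hi⟩
  rw [hU, hmono.measure_iUnion]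
  refine iSup_le fun n => ?_
  refine H n (fun i => X i) (fun i => hX i) (hG n) a ha (h.trans (measure_mono ?_)) b hb
  intro ω hω i
  exact hω i

lemma aux_main_upper {Ω : Type*} [MeasurableSpace Ω] {μ : Measure Ω} [IsProbabilityMeasure μ]
    (S : ℝ≥0) (hS : 0 < (S:ℝ))
    (G : ℝ → Ω → ℝ) (hGmeas : ∀ t, Measurable (G t))
    (hGauss : ∀ (n : ℕ) (t c : Fin n → ℝ), ∃ v : ℝ≥0,
      Measure.map (fun ω => ∑ i, c i * G (t i) ω) μ = gaussianReal 0 v)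
    (hvar : ∀ t ∈ Set.Icc (0:ℝ) 1, ∃ v : ℝ≥0, v ≤ S ∧ μ.map (G t) = gaussianReal 0 v)
    (hcont : ∀ᵐ ω ∂μ, ContinuousOn (fun t => G t ω) (Set.Icc (0 : ℝ) 1))
    (Z : Ω → ℝ) (hZ : ∀ ω, Z ω = ⨆ t : Set.Icc (0 : ℝ) 1, |G (t : ℝ) ω|)
    (ε : ℝ) (hε : 0 < ε) (hε1 : ε < 1) :
    ∃ K > 0, ∀ u ≥ 0, μ.real {ω | Z ω > u} ≤ K * rexp (-((1-ε)*u)^2/(2*S)) := by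
  obtain ⟨C, κ, hC, hκ, H⟩ := aux_fernique_nat
  obtain ⟨a, ha, haκ⟩ : ∃ a : ℝ, 0 < a ∧ (1-ε)^2/(2*S) ≤ κ * (ε/a)^2 := by
    refine ⟨√(κ * ε^2 * (2*S)), by positivity, ?_⟩
    rw [div_pow, Real.sq_sqrt (by positivity)]
    have : κ * (ε ^ 2 / (κ * ε ^ 2 * (2 * S))) = 1 / (2*S) := by field_simp
    rw [this]
    gcongr
    nlinarith
  let e : ℕ → Set.Icc (0:ℝ) 1 := TopologicalSpace.denseSeq (Set.Icc (0:ℝ) 1)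
  have hde : DenseRange e := TopologicalSpace.denseRange_denseSeq _
  -- the bad events
  let B : ℝ → ℝ → Set Ω := fun δ b =>
    {ω | ∃ i j : ℕ, dist (e i) (e j) < δ ∧ b < |G (e i) ω - G (e j) ω|}
  have hBm : ∀ δ b, MeasurableSet (B δ b) := by
    intro δ b
    have : B δ b = ⋃ i : ℕ, ⋃ j : ℕ, {ω | dist (e i) (e j) < δ ∧ b < |G (e i) ω - G (e j) ω|} := by
      ext ω
      simp [B]
    rw [this]
    refine MeasurableSet.iUnion fun i => MeasurableSet.iUnion fun j => ?_
    refine MeasurableSet.inter (MeasurableSet.const _) ?_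
    exact measurableSet_lt measurable_const (((hGmeas _).sub (hGmeas _)).abs)
  have hlim : Tendsto (fun n : ℕ => μ (B (1/((n:ℝ)+1)) a)) atTop
      (nhds (μ (⋂ n : ℕ, B (1/((n:ℝ)+1)) a))) := by
    apply tendsto_measure_iInter_atTop
    · exact fun n => (hBm _ _).nullMeasurableSet
    · intro m n hmn ω hω
      obtain ⟨i, j, h1, h2⟩ := hω
      refine ⟨i, j, h1.trans_le ?_, h2⟩
      exact Nat.one_div_le_one_div hmn
    · exact ⟨0, measure_ne_top _ _⟩
  have hzero : μ (⋂ n : ℕ, B (1/((n:ℝ)+1)) a) = 0 := by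
    refine measure_mono_null ?_ (ae_iff.1 hcont)
    intro ω hω hc
    have huc : UniformContinuous (fun t : Set.Icc (0:ℝ) 1 => G t ω) :=
      CompactSpace.uniformContinuous_of_continuous (continuousOn_iff_continuous_domRestrict.1 hc)
    obtain ⟨δ, hδ, hd⟩ := Metric.uniformContinuous_iff.1 huc a ha
    obtain ⟨n, hn⟩ := exists_nat_one_div_lt hδ
    obtain ⟨i, j, h1, h2⟩ := Set.mem_iInter.1 hω n
    have := hd (h1.trans hn)
    rw [Real.dist_eq] at this
    linarith
  rw [hzero] at hlim
  obtain ⟨n, hn⟩ := (hlim.eventually_lt_const (show (0:ℝ≥0∞) < 1/4 by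
    simp)).exists
  set δ : ℝ := 1/((n:ℝ)+1) with hδ
  have hδ0 : 0 < δ := by positivity
  -- Fernique
  let w : ℕ → ℝ := fun k => if dist (e k.unpair.1) (e k.unpair.2) < δ then 1 else 0
  let X : ℕ → Ω → ℝ := fun k ω => w k * G (e k.unpair.1) ω - w k * G (e k.unpair.2) ω
  have hXm : ∀ k, Measurable (X k) := fun k =>
    ((hGmeas _).const_mul _).sub ((hGmeas _).const_mul _)
  have hXG : ∀ (n : ℕ) (c : Fin n → ℝ), ∃ v : ℝ≥0,
      μ.map (fun ω => ∑ i, c i * X i ω) = gaussianReal 0 v := by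
    intro n c
    obtain ⟨v, hv⟩ := hGauss (n+n)
      (Fin.append (fun i : Fin n => (e (i:ℕ).unpair.1 : ℝ)) (fun i : Fin n => (e (i:ℕ).unpair.2 : ℝ)))
      (Fin.append (fun i : Fin n => c i * w i) (fun i : Fin n => -(c i * w i)))
    refine ⟨v, ?_⟩
    rw [← hv]
    congr 1
    ext ω
    rw [Fin.sum_univ_add, ← Finset.sum_add_distrib]
    refine Finset.sum_congr rfl fun i _ => ?_
    simp only [Fin.append_left, Fin.append_right, X]
    ring
  have hXB : ∀ b : ℝ, 0 ≤ b → {ω | ∃ k, b < |X k ω|} = B δ b := by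
    intro b hb
    ext ω
    constructor
    · rintro ⟨k, hk⟩
      refine ⟨k.unpair.1, k.unpair.2, ?_⟩
      by_cases hd : dist (e k.unpair.1) (e k.unpair.2) < δ
      · refine ⟨hd, ?_⟩
        simpa [X, w, hd] using hk
      · exfalso
        simp only [X, w, hd, if_false, zero_mul, sub_zero, abs_zero] at hk
        linarith
    · rintro ⟨i, j, hd, hk⟩
      refine ⟨Nat.pair i j, ?_⟩
      simpa [X, w, hd] using hk
  have h34 : 3/4 ≤ μ {ω | ∀ i, |X i ω| ≤ a} := by
    have : {ω | ∀ i, |X i ω| ≤ a} = (B δ a)ᶜ := by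
      rw [← hXB a ha.le]
      ext ω
      simp
    rw [this, prob_compl_eq_one_sub (hBm _ _)]
    have h1 : (3/4 : ℝ≥0∞) = 1 - 1/4 := by
      rw [← ENNReal.toReal_eq_toReal_iff' (by finiteness) (by finiteness), ENNReal.toReal_sub_of_le (by simp) (by simp)]
      norm_num
    rw [h1]
    exact tsub_le_tsub_left hn.le _
  have HB : ∀ b : ℝ, 0 ≤ b → μ.real (B δ b) ≤ C * rexp (-(κ * (b/a)^2)) := by
    intro b hb
    rw [← hXB b hb]
    exact ENNReal.toReal_le_of_le_ofReal (by positivity) (H X hXm hXG a ha h34 b hb)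
  -- finite net
  obtain ⟨F, hF⟩ := isCompact_univ.elim_finite_subcover
    (fun j : ℕ => Metric.ball (e j) δ) (fun j => Metric.isOpen_ball) (by
      intro x _
      obtain ⟨j, hj⟩ := hde.exists_dist_lt x hδ0
      exact Set.mem_iUnion.2 ⟨j, hj⟩)
  refine ⟨F.card * 2 + C, by positivity, fun u hu => ?_⟩
  have hsub : {ω | Z ω > u} ≤ᵐ[μ]
      ((⋃ j ∈ F, {ω | (1-ε)*u ≤ |G (e j) ω|}) ∪ B δ (ε*u) : Set Ω) := by
    filter_upwards [hcont] with ω hc hω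
    change Z ω > u at hω
    rw [hZ] at hω
    obtain ⟨t, ht⟩ := exists_lt_of_lt_ciSup hω
    have hct : Continuous (fun t : Set.Icc (0:ℝ) 1 => |G t ω|) :=
      (continuousOn_iff_continuous_domRestrict.1 hc).abs
    obtain ⟨i, hi⟩ := hde.exists_mem_open (isOpen_lt continuous_const hct) ⟨t, ht⟩
    change u < |G (e i) ω| at hi
    obtain ⟨j, hjF, hj⟩ := Set.mem_iUnion₂.1 (hF (Set.mem_univ (e i)))
    by_cases hb : ε * u < |G (e i) ω - G (e j) ω|
    · exact Or.inr ⟨i, j, hj, hb⟩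
    · refine Or.inl (Set.mem_iUnion₂.2 ⟨j, hjF, ?_⟩)
      change (1-ε)*u ≤ |G (e j) ω|
      have := abs_sub_abs_le_abs_sub (G (e i) ω) (G (e j) ω)
      linarith
  have h1 : μ.real {ω | Z ω > u} ≤ μ.real ((⋃ j ∈ F, {ω | (1-ε)*u ≤ |G (e j) ω|}) ∪ B δ (ε*u)) :=
    ENNReal.toReal_mono (measure_ne_top _ _) (measure_mono_ae hsub)
  have h2 : μ.real (⋃ j ∈ F, {ω | (1-ε)*u ≤ |G (e j) ω|}) ≤
      ∑ j ∈ F, 2 * rexp (-((1-ε)*u)^2/(2*S)) := by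
    refine (measureReal_biUnion_finset_le _ _).trans (Finset.sum_le_sum fun j _ => ?_)
    obtain ⟨v, hv, hm⟩ := hvar (e j) (e j).2
    exact aux_upper _ v S hv hm _ (mul_nonneg (by linarith) hu)
  rw [Finset.sum_const, nsmul_eq_mul] at h2
  have h3 : μ.real (B δ (ε*u)) ≤ C * rexp (-((1-ε)*u)^2/(2*S)) := by
    refine (HB _ (by positivity)).trans ?_
    gcongr
    rw [neg_div]
    apply neg_le_neg
    calc ((1-ε)*u)^2/(2*S) = (1-ε)^2/(2*S) * u^2 := by ring
      _ ≤ κ * (ε/a)^2 * u^2 := by gcongr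
      _ = _ := by ring
  calc _ ≤ _ := h1
    _ ≤ _ := measureReal_union_le _ _
    _ ≤ _ := add_le_add h2 h3
    _ = _ := by ring

theorem stmt_15
    {Ω : Type*} [MeasureSpace Ω] [IsProbabilityMeasure (ℙ : Measure Ω)]
    (f : ℝ → ℝ) (hfm : Measurable f)
    (hfb : ∀ r : ℝ, 0 < r → ∃ M : ℝ, ∀ x ∈ Set.Icc (0 : ℝ) r, |f x| ≤ M)
    (hf2 : 0 < ∫ y in (0 : ℝ)..1, f y ^ 2)
    (G : ℝ → Ω → ℝ) (hGmeas : ∀ t, Measurable (G t))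
    (hGauss : ∀ (n : ℕ) (t c : Fin n → ℝ), ∃ v : ℝ≥0,
      Measure.map (fun ω => ∑ i, c i * G (t i) ω) ℙ = gaussianReal 0 v)
    (hcov : ∀ s t : ℝ, 0 ≤ s → s ≤ t →
      ∫ ω, G s ω * G t ω ∂ℙ = ∫ x in (0 : ℝ)..s, f (s - x) * f (t - x))
    (hcont : ∀ᵐ ω ∂ℙ, ContinuousOn (fun t => G t ω) (Set.Icc (0 : ℝ) 1))
    (Z : Ω → ℝ) (hZ : ∀ ω, Z ω = ⨆ t : Set.Icc (0 : ℝ) 1, |G (t : ℝ) ω|)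
    (hfin : ∀ᵐ ω ∂ℙ, BddAbove (Set.range fun t : Set.Icc (0 : ℝ) 1 => |G (t : ℝ) ω|)) :
    (fun u : ℝ => -Real.log (ℙ {ω | Z ω > u}).toReal)
      ~[atTop] fun u : ℝ => u ^ 2 / (2 * ∫ y in (0 : ℝ)..1, f y ^ 2) := by
  set I := ∫ y in (0 : ℝ)..1, f y ^ 2 with hI
  have hvar0 : ∀ t : ℝ, 0 ≤ t → ∃ v : ℝ≥0, (v:ℝ) = ∫ y in (0:ℝ)..t, f y ^ 2 ∧
      Measure.map (G t) ℙ = gaussianReal 0 v := by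
    intro t ht
    obtain ⟨v, hv⟩ := hGauss 1 (fun _ => t) (fun _ => 1)
    simp only [Finset.univ_unique, one_mul, Finset.sum_const, Finset.card_singleton,
      one_smul] at hv
    refine ⟨v, ?_, hv⟩
    have h1 := hcov t t ht le_rfl
    have h2 : ∫ x in (0:ℝ)..t, f (t - x) * f (t - x) = ∫ y in (0:ℝ)..t, f y ^ 2 := by
      have := intervalIntegral.integral_comp_sub_left (a := 0) (b := t) (fun y => f y ^ 2) t
      simp only [sub_self, sub_zero] at this
      rw [← this]
      simp only [pow_two]
    have h3 : ∫ ω, G t ω * G t ω ∂ℙ = ∫ x, x * x ∂(Measure.map (G t) (ℙ : Measure Ω)) :=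
      (integral_map (φ := G t) (f := fun x => x * x) (hGmeas t).aemeasurable (by fun_prop)).symm
    rw [← h2, ← h1, h3, hv]
    have h4 := variance_fun_id_gaussianReal (μ := 0) (v := v)
    rw [variance_eq_integral measurable_id'.aemeasurable] at h4
    simp only [integral_id_gaussianReal, sub_zero, pow_two] at h4
    exact h4.symm
  have hint : IntervalIntegrable (fun y => f y ^ 2) volume 0 1 := by
    obtain ⟨M, hM⟩ := hfb 1 one_pos
    rw [intervalIntegrable_iff_integrableOn_Ioc_of_le zero_le_one]
    refine Measure.integrableOn_of_bounded (M := M^2) (by simp) (by fun_prop) ?_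
    rw [ae_restrict_iff' measurableSet_Ioc]
    refine ae_of_all _ fun x hx => ?_
    rw [norm_pow, Real.norm_eq_abs]
    have := hM x ⟨hx.1.le, hx.2⟩
    gcongr
  obtain ⟨S, hSI, hS1⟩ := hvar0 1 zero_le_one
  rw [← hI] at hSI
  have hSpos : 0 < (S:ℝ) := by rw [hSI]; exact hf2
  have hvar : ∀ t ∈ Set.Icc (0:ℝ) 1, ∃ v : ℝ≥0, v ≤ S ∧
      Measure.map (G t) (ℙ : Measure Ω) = gaussianReal 0 v := by
    intro t ht
    obtain ⟨v, hv, hm⟩ := hvar0 t ht.1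
    refine ⟨v, ?_, hm⟩
    rw [← NNReal.coe_le_coe, hv, hSI]
    exact intervalIntegral.integral_mono_interval le_rfl ht.1 ht.2
      (ae_of_all _ fun x => sq_nonneg _) hint
  rw [← hSI]
  refine aux_asymp (fun u => (ℙ {ω | Z ω > u}).toReal) S hSpos ?_ ?_
  · obtain ⟨c, hc, h⟩ := aux_lower S hSpos
    refine ⟨c, hc, fun u hu => (h u hu).trans ?_⟩
    rw [← hS1, measureReal_def, Measure.map_apply (hGmeas 1)
      (measurableSet_lt measurable_const measurable_id'.abs)]
    refine ENNReal.toReal_mono (measure_ne_top _ _) (measure_mono_ae ?_)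
    filter_upwards [hfin] with ω hb hω
    change u < |G 1 ω| at hω
    change Z ω > u
    rw [hZ]
    exact hω.trans_le (le_ciSup hb (⟨1, by simp⟩ : Set.Icc (0:ℝ) 1))
  · intro ε h0 h1
    exact aux_main_upper S hSpos G hGmeas hGauss hvar hcont Z hZ ε h0 h1
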